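/- Let μ be a complex number and n a positive even integer. Then b_n(0,1,μ) = det_{1≤i,j≤n}( −δ_{i−1,j} + C(μ+i+j−3, j) ) equals ( ∏_{k=0}^{n/2−1} Q1(k) ) · ( ∏_{k=1}^{n/2} Q2(k) ), where Q1(k) = 2 (μ/2+2k)_{k+1} (μ+2k−1)_{k+1} / ( (k+2)_{k+1} (μ/2+k)_{k+1} ) and Q2(k) = (μ+2k−2) (μ/2+2k−1)_{k−1} (μ+2k+1)_{k−1} / ( k (k)_{k−1} (μ/2+k+1)_{k−1} ); the identity is understood after clearing all denominators (equivalently, it holds whenever all denominators are nonzero). -/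

import Mathlib

/-- Generalized binomial coefficient `C(x,k) = x(x-1)⋯(x-k+1)/k!` for complex `x`. -/
noncomputable def gbinom (x : ℂ) (k : ℕ) : ℂ :=
  (∏ i ∈ Finset.range k, (x - i)) / (k.factorial : ℂ)

/-- Pochhammer symbol `(x)_k = x(x+1)⋯(x+k-1)`. -/
noncomputable def poch (x : ℂ) (k : ℕ) : ℂ :=
  ∏ i ∈ Finset.range k, (x + i)
/-- `b_n(I,J,μ)`: determinant of the `n×n` matrix with rows indexed by
`i = I,…,n-1+I`, columns indexed by `j = J,…,n-1+J`, and entries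
`-δ_{i,j} + C(μ+i+j-2, j)`. -/
noncomputable def bdet (μ : ℂ) (n I J : ℕ) : ℂ :=
  Matrix.det (Matrix.of fun i j : Fin n =>
    (if I + i.1 = J + j.1 then (-1 : ℂ) else 0)
      + gbinom (μ + ((I + i.1 : ℕ) : ℂ) + ((J + j.1 : ℕ) : ℂ) - 2) (J + j.1))
noncomputable def Q1 (μ : ℂ) (k : ℕ) : ℂ :=
  2 * poch (μ / 2 + 2 * k) (k + 1) * poch (μ + 2 * k - 1) (k + 1)
    / (poch ((k : ℂ) + 2) (k + 1) * poch (μ / 2 + k) (k + 1))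

noncomputable def Q2 (μ : ℂ) (k : ℕ) : ℂ :=
  (μ + 2 * k - 2) * poch (μ / 2 + 2 * k - 1) (k - 1) * poch (μ + 2 * k + 1) (k - 1)
    / ((k : ℂ) * poch (k : ℂ) (k - 1) * poch (μ / 2 + k + 1) (k - 1))

/-- The rising product `x(x+1)⋯(x+k-1)` over `ℚ`. -/
def rising (x : ℚ) (k : ℕ) : ℚ := ∏ i ∈ Finset.range k, (x + i)

theorem rising_zero (x : ℚ) : rising x 0 = 1 := by simp [rising]

theorem rising_succ (x : ℚ) (k : ℕ) : rising x (k + 1) = rising x k * (x + k) :=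
  Finset.prod_range_succ _ _

theorem rising_succ_left (x : ℚ) (k : ℕ) : rising x (k + 1) = x * rising (x + 1) k := by
  simp only [rising, Finset.prod_range_succ', Nat.cast_zero, add_zero, mul_comm x]
  congr 1
  refine Finset.prod_congr rfl fun i _ => ?_
  push_cast
  ring

theorem rising_natCast (a k : ℕ) :
    rising ((a : ℚ) + 1) k = ((a + k).factorial : ℚ) / (a.factorial : ℚ) := by
  have h : (a.factorial : ℚ) ≠ 0 := by exact_mod_cast a.factorial_ne_zero
  rw [eq_div_iff h]
  induction k with
  | zero => simp [rising_zero]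
  | succ k ih =>
    rw [rising_succ, ← add_assoc, Nat.factorial_succ]
    push_cast
    linear_combination ((a : ℚ) + 1 + k) * ih

/-- The summand of the cleared Pfaff–Saalschütz identity. -/
def saalTerm (a b c : ℚ) (n k : ℕ) : ℚ :=
  n.choose k * rising a k * rising b k * rising (c + k) (n - k) * rising (c - a - b) (n - k)

theorem saalTerm_partial_sum (a b c : ℚ) (n j : ℕ) (hj : j ≤ n) :
    ∑ k ∈ Finset.range (j + 1),
        (saalTerm a b c (n + 1) k - (c - a + n) * (c - b + n) * saalTerm a b c n k) =
      -((a + j) * (b + j)) * saalTerm a b c n j := by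
  induction j with
  | zero =>
    simp only [zero_add, Finset.sum_range_one, saalTerm, Nat.choose_zero_right, rising_zero,
      Nat.sub_zero, rising_succ, Nat.cast_zero, add_zero]
    push_cast
    ring
  | succ j ih =>
    rw [Finset.sum_range_succ, ih (by omega)]
    obtain ⟨d, rfl⟩ : ∃ d, n = j + 1 + d := ⟨n - (j + 1), by omega⟩
    have e1 : j + 1 + d + 1 - (j + 1) = d + 1 := by omega
    have e2 : j + 1 + d - (j + 1) = d := by omega
    have e3 : j + 1 + d - j = d + 1 := by omega
    have hc : ((j + 1 + d).choose j : ℚ) * (d + 1) = (j + 1 + d).choose (j + 1) * (j + 1) := by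
      have := Nat.choose_succ_right_eq (j + 1 + d) j
      rw [e3] at this
      exact_mod_cast this.symm
    have hl : rising (c + j) (d + 1) = (c + j) * rising (c + (j + 1)) d := by
      rw [rising_succ_left, add_assoc]
    simp only [saalTerm, e1, e2, e3, Nat.choose_succ_succ (j + 1 + d) j, rising_succ]
    rw [← rising_succ, hl]
    push_cast
    linear_combination (a + j) * (b + j) * rising a j * rising b j * rising (c + (j + 1)) d *
      rising (c - a - b) d * (c - a - b + d) * hc

theorem saalschutz (a b c : ℚ) (n : ℕ) :
    ∑ k ∈ Finset.range (n + 1), saalTerm a b c n k = rising (c - a) n * rising (c - b) n := by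
  induction n with
  | zero => simp [saalTerm, rising_zero]
  | succ n ih =>
    have h := saalTerm_partial_sum a b c n n le_rfl
    rw [Finset.sum_sub_distrib, ← Finset.mul_sum, ih] at h
    have hl : saalTerm a b c (n + 1) (n + 1) = (a + n) * (b + n) * saalTerm a b c n n := by
      simp only [saalTerm, Nat.choose_self, Nat.sub_self, rising_zero, rising_succ]
      ring
    rw [Finset.sum_range_succ, hl, rising_succ, rising_succ]
    linear_combination h

open PowerSeries in
theorem PowerSeries.coeff_one_sub_X_pow_choose (n p : ℕ) :
    coeff p ((1 - X : ℚ⟦X⟧) ^ n) = (-1) ^ p * n.choose p := by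
  have h : (1 - X : ℚ⟦X⟧) ^ n =
      (((1 + Polynomial.X : Polynomial ℚ) ^ n).comp (Polynomial.C (-1) * Polynomial.X) :
        Polynomial ℚ) := by
    simp [sub_eq_add_neg]
  rw [h, Polynomial.coeff_coe, Polynomial.comp_C_mul_X_coeff, Polynomial.coeff_one_add_X_pow,
    mul_comm]

/-- `u(x) ↦ (1-x)^{-(2g+1)} u(1/(1-x))` on polynomials. -/
noncomputable def geomSubst (g : ℕ) : Polynomial ℚ →ₗ[ℚ] PowerSeries ℚ :=
  (Polynomial.basisMonomials ℚ).constr ℚ fun i => (PowerSeries.invOneSubPow ℚ (2 * g + 1 + i)).val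

theorem geomSubst_X_pow (g i : ℕ) :
    geomSubst g (Polynomial.X ^ i) = (PowerSeries.invOneSubPow ℚ (2 * g + 1 + i)).val := by
  have h := (Polynomial.basisMonomials ℚ).constr_basis ℚ
    (fun i => (PowerSeries.invOneSubPow ℚ (2 * g + 1 + i)).val) i
  simp only [Polynomial.coe_basisMonomials, Polynomial.monomial_one_right_eq_X_pow] at h
  exact h

/-- The inclusion of polynomials into power series, as a linear map. -/
noncomputable def polyIncl : Polynomial ℚ →ₗ[ℚ] PowerSeries ℚ :=
  (Polynomial.coeToPowerSeries.algHom ℚ).toLinearMap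

theorem polyIncl_apply (p : Polynomial ℚ) : polyIncl p = (p : PowerSeries ℚ) := by
  simp [polyIncl, Polynomial.coeToPowerSeries.algHom_apply]

/-- The reflection `u(x) ↦ u(1-x)`. -/
noncomputable def reflOne : Polynomial ℚ →ₗ[ℚ] Polynomial ℚ :=
  (Polynomial.aeval (1 - Polynomial.X : Polynomial ℚ)).toLinearMap

/-- The functional `f ↦ [x^{2m}] (1-x)^{m+g} f`. -/
noncomputable def evenFunctional (g m : ℕ) : PowerSeries ℚ →ₗ[ℚ] ℚ :=
  (PowerSeries.coeff (2 * m)).comp (LinearMap.mulLeft ℚ ((1 - PowerSeries.X) ^ (m + g)))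

/-- The functional `f ↦ [x^{2m+1}] (1-x)^{m+g} (2-x) f`. -/
noncomputable def oddFunctional (g m : ℕ) : PowerSeries ℚ →ₗ[ℚ] ℚ :=
  (PowerSeries.coeff (2 * m + 1)).comp
    (LinearMap.mulLeft ℚ ((1 - PowerSeries.X) ^ (m + g) * (2 - PowerSeries.X)))

theorem PowerSeries.coeff_succ_two_sub_X_mul (f : PowerSeries ℚ) (p : ℕ) :
    PowerSeries.coeff (p + 1) ((2 - PowerSeries.X) * f) =
      2 * PowerSeries.coeff (p + 1) f - PowerSeries.coeff p f := by
  rw [sub_mul, map_sub, PowerSeries.coeff_succ_X_mul]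
  congr 1
  rw [show (2 : PowerSeries ℚ) = PowerSeries.C 2 by rw [map_ofNat], PowerSeries.coeff_C_mul]

theorem one_sub_X_pow_mul_geomSubst (m h i : ℕ) :
    (1 - PowerSeries.X) ^ (m + (m + h)) * geomSubst (m + h) (Polynomial.X ^ i) =
      PowerSeries.mk fun n => ((h + i + n).choose (h + i) : ℚ) := by
  rw [geomSubst_X_pow, show 2 * (m + h) + 1 + i = (h + i + 1) + (m + (m + h)) by ring,
    PowerSeries.one_sub_pow_mul_invOneSubPow_val_add_eq_invOneSubPow_val,
    PowerSeries.invOneSubPow_val_succ_eq_mk_add_choose]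

theorem evenFunctional_comp_geomSubst (g m : ℕ) (hm : m ≤ g) :
    (evenFunctional g m).comp (geomSubst g) =
      (evenFunctional g m).comp (polyIncl.comp reflOne) := by
  obtain ⟨h, rfl⟩ := Nat.exists_eq_add_of_le hm
  refine (Polynomial.basisMonomials ℚ).ext fun i => ?_
  simp only [Polynomial.coe_basisMonomials, Polynomial.monomial_one_right_eq_X_pow, evenFunctional,
    LinearMap.comp_apply, LinearMap.mulLeft_apply,
    one_sub_X_pow_mul_geomSubst, polyIncl_apply, reflOne, AlgHom.toLinearMap_apply, map_pow,
    Polynomial.aeval_X, Polynomial.coe_pow, Polynomial.coe_sub, Polynomial.coe_one,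
    Polynomial.coe_X, ← pow_add, PowerSeries.coeff_mk, PowerSeries.coeff_one_sub_X_pow_choose]
  rw [show m + (m + h) + i = h + i + 2 * m by ring, Nat.choose_symm_add]
  simp

theorem oddFunctional_comp_geomSubst (g m : ℕ) (hm : m ≤ g) :
    (oddFunctional g m).comp (geomSubst g) =
      -(oddFunctional g m).comp (polyIncl.comp reflOne) := by
  obtain ⟨h, rfl⟩ := Nat.exists_eq_add_of_le hm
  refine (Polynomial.basisMonomials ℚ).ext fun i => ?_
  simp only [Polynomial.coe_basisMonomials, Polynomial.monomial_one_right_eq_X_pow, oddFunctional,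
    LinearMap.comp_apply, LinearMap.mulLeft_apply, LinearMap.neg_apply,
    mul_comm _ (2 - PowerSeries.X : PowerSeries ℚ), mul_assoc,
    one_sub_X_pow_mul_geomSubst, polyIncl_apply, reflOne, AlgHom.toLinearMap_apply, map_pow,
    Polynomial.aeval_X, Polynomial.coe_pow, Polynomial.coe_sub, Polynomial.coe_one,
    Polynomial.coe_X, ← pow_add, PowerSeries.coeff_succ_two_sub_X_mul,
    PowerSeries.coeff_mk, PowerSeries.coeff_one_sub_X_pow_choose]
  rw [show m + (m + h) + i = h + i + 2 * m by ring, Nat.choose_symm_add, Nat.choose_symm_add,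
    ← add_assoc, Nat.choose_succ_succ (h + i + 2 * m) (2 * m), pow_succ]
  simp
  ring

/-- `u ↦ M u - u` with `M` the substitution `geomSubst`. -/
noncomputable def substDiff (g : ℕ) : Polynomial ℚ →ₗ[ℚ] PowerSeries ℚ := geomSubst g - polyIncl

theorem evenFunctional_substDiff (g m : ℕ) (hm : m ≤ g) (u : Polynomial ℚ) (ε : ℚ)
    (hu : reflOne u = ε • u) :
    evenFunctional g m (substDiff g u) = (ε - 1) * evenFunctional g m u := by
  have h := LinearMap.congr_fun (evenFunctional_comp_geomSubst g m hm) u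
  simp only [LinearMap.comp_apply, hu, map_smul, smul_eq_mul, polyIncl_apply] at h
  rw [substDiff, LinearMap.sub_apply, map_sub, h, polyIncl_apply]
  ring

theorem oddFunctional_substDiff (g m : ℕ) (hm : m ≤ g) (u : Polynomial ℚ) (ε : ℚ)
    (hu : reflOne u = ε • u) :
    oddFunctional g m (substDiff g u) = (-ε - 1) * oddFunctional g m u := by
  have h := LinearMap.congr_fun (oddFunctional_comp_geomSubst g m hm) u
  simp only [LinearMap.comp_apply, LinearMap.neg_apply, hu, map_smul, smul_eq_mul,
    polyIncl_apply] at h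
  rw [substDiff, LinearMap.sub_apply, map_sub, h, polyIncl_apply]
  ring

/-- The reflection-invariant polynomials `(x(1-x))^k`. -/
noncomputable def symPoly (k : ℕ) : Polynomial ℚ := (Polynomial.X * (1 - Polynomial.X)) ^ k

/-- The reflection-anti-invariant polynomials `(1-2x)(x(1-x))^k`. -/
noncomputable def antiPoly (k : ℕ) : Polynomial ℚ := (1 - 2 * Polynomial.X) * symPoly k

theorem reflOne_symPoly (k : ℕ) : reflOne (symPoly k) = (1 : ℚ) • symPoly k := by
  simp [reflOne, symPoly, mul_comm]

theorem reflOne_antiPoly (k : ℕ) : reflOne (antiPoly k) = (-1 : ℚ) • antiPoly k := by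
  have h := reflOne_symPoly k
  simp only [reflOne, AlgHom.toLinearMap_apply, one_smul] at h
  simp only [reflOne, antiPoly, AlgHom.toLinearMap_apply, map_mul, h, map_sub, map_one, map_ofNat,
    Polynomial.aeval_X, neg_smul, one_smul]
  ring

open PowerSeries in
theorem coeff_one_sub_two_X_mul (n p q : ℕ) (h : p + q = n + 1) :
    coeff p ((1 - 2 * X : ℚ⟦X⟧) * (1 - X : ℚ⟦X⟧) ^ n) =
      (-1 : ℚ) ^ p * ((n + 1 + p) * n.factorial / (p.factorial * q.factorial)) := by
  have hC : (2 : ℚ⟦X⟧) = C 2 := by rw [map_ofNat]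
  rw [sub_mul, one_mul, map_sub, coeff_one_sub_X_pow_choose, mul_assoc, hC, coeff_C_mul]
  rcases p with _ | p
  · obtain rfl : q = n + 1 := by omega
    simp [Nat.factorial_succ]
    field_simp
  obtain rfl : n = p + q := by omega
  rw [coeff_succ_X_mul, coeff_one_sub_X_pow_choose, Nat.cast_add_choose]
  rcases q with _ | q
  · simp [Nat.factorial_succ]
    field_simp
    ring
  rw [show p + (q + 1) = p + 1 + q by ring, Nat.cast_add_choose]
  simp only [Nat.factorial_succ]
  push_cast
  field_simp
  ring

open PowerSeries in
theorem coeff_two_sub_X_mul (n p q : ℕ) (h : p + q = n + 1) :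
    coeff p ((2 - X : ℚ⟦X⟧) * (1 - X : ℚ⟦X⟧) ^ n) =
      (-1 : ℚ) ^ p * ((n + 1 + q) * n.factorial / (p.factorial * q.factorial)) := by
  rcases p with _ | p
  · obtain rfl : q = n + 1 := by omega
    have hc : constantCoeff (2 : ℚ⟦X⟧) = 2 := map_ofNat _ 2
    simp [Nat.factorial_succ, hc]
    field_simp
    ring
  obtain rfl : n = p + q := by omega
  rw [coeff_succ_two_sub_X_mul, coeff_one_sub_X_pow_choose, coeff_one_sub_X_pow_choose,
    Nat.cast_add_choose]
  rcases q with _ | q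
  · simp [Nat.factorial_succ]
    field_simp
    ring
  rw [show p + (q + 1) = p + 1 + q by ring, Nat.cast_add_choose]
  simp only [Nat.factorial_succ]
  push_cast
  field_simp
  ring

theorem descFactorial_div_factorial (p k : ℕ) :
    ((p + k).descFactorial k : ℚ) / (p + k).factorial = 1 / p.factorial := by
  have h := Nat.factorial_mul_descFactorial (Nat.le_add_left k p)
  rw [Nat.add_sub_cancel] at h
  rw [div_eq_div_iff (by positivity) (by positivity), ← h]
  push_cast
  ring

/-- The common factor of `evenFunctional g m (antiPoly k)`. -/
def evenBase (g m k : ℕ) : ℚ :=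
  (g + k + m).factorial * (((2 * m).descFactorial k : ℚ) / (2 * m).factorial) /
    (g + 1 + 2 * k - m).factorial

/-- The common factor of `oddFunctional g m (symPoly k)`. -/
def oddBase (g m k : ℕ) : ℚ :=
  (g + k + m).factorial * (((2 * m + 1).descFactorial k : ℚ) / (2 * m + 1).factorial) /
    (g + 2 * k - m).factorial

theorem evenFunctional_antiPoly (g m k : ℕ) (hm : m ≤ g) :
    evenFunctional g m (antiPoly k) = (-1) ^ k * ((3 * m + g + 1) * evenBase g m k) := by
  have hP : (1 - PowerSeries.X) ^ (m + g) * (antiPoly k : PowerSeries ℚ) =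
      PowerSeries.X ^ k * ((1 - 2 * PowerSeries.X) * (1 - PowerSeries.X) ^ (g + k + m)) := by
    simp only [antiPoly, symPoly, Polynomial.coe_mul, Polynomial.coe_sub, Polynomial.coe_one,
      Polynomial.coe_X, Polynomial.coe_pow, mul_pow]
    rw [show ((2 : Polynomial ℚ) : PowerSeries ℚ) = 2 by
      rw [← map_ofNat Polynomial.C 2, Polynomial.coe_C, map_ofNat]]
    ring
  rw [evenFunctional, LinearMap.comp_apply, LinearMap.mulLeft_apply, hP,
    PowerSeries.coeff_X_pow_mul']
  split_ifs with hk
  · obtain ⟨p, hp⟩ := Nat.exists_eq_add_of_le' hk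
    rw [hp, Nat.add_sub_cancel, coeff_one_sub_two_X_mul (g + k + m) p (g + 1 + 2 * k - m) (by omega),
      evenBase, hp, descFactorial_div_factorial]
    have hs : (-1 : ℚ) ^ p = (-1) ^ k := by
      rw [neg_one_pow_eq_pow_mod_two p, neg_one_pow_eq_pow_mod_two k, show p % 2 = k % 2 by omega]
    have hq : (2 * m : ℚ) = p + k := by exact_mod_cast hp
    rw [hs]
    push_cast
    rw [show (3 * m + g + 1 : ℚ) = g + k + m + 1 + p by linear_combination hq]
    field_simp
  · rw [evenBase, Nat.descFactorial_of_lt (by omega)]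
    simp

theorem oddFunctional_symPoly (g m k : ℕ) (hm : m ≤ g) :
    oddFunctional g m (symPoly k) =
      (-1) ^ (k + 1) * ((2 * g + 3 * k + 1) * oddBase g m k) := by
  have hP : (1 - PowerSeries.X) ^ (m + g) * (2 - PowerSeries.X) * (symPoly k : PowerSeries ℚ) =
      PowerSeries.X ^ k * ((2 - PowerSeries.X) * (1 - PowerSeries.X) ^ (g + k + m)) := by
    simp only [symPoly, Polynomial.coe_mul, Polynomial.coe_sub, Polynomial.coe_one,
      Polynomial.coe_X, Polynomial.coe_pow, mul_pow]
    ring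
  rw [oddFunctional, LinearMap.comp_apply, LinearMap.mulLeft_apply, hP,
    PowerSeries.coeff_X_pow_mul']
  split_ifs with hk
  · obtain ⟨p, hp⟩ := Nat.exists_eq_add_of_le' hk
    have hn : g + 2 * k - m + p = g + k + m + 1 := by omega
    rw [hp, Nat.add_sub_cancel, coeff_two_sub_X_mul (g + k + m) p (g + 2 * k - m) (by omega),
      oddBase, hp, descFactorial_div_factorial]
    have hs : (-1 : ℚ) ^ p = (-1) ^ (k + 1) := by
      rw [neg_one_pow_eq_pow_mod_two p, neg_one_pow_eq_pow_mod_two (k + 1),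
        show p % 2 = (k + 1) % 2 by omega]
    have hq : (2 * m + 1 : ℚ) = p + k := by exact_mod_cast hp
    have hn' : ((g + 2 * k - m : ℕ) : ℚ) + p = g + k + m + 1 := by exact_mod_cast hn
    rw [hs]
    push_cast
    rw [show (g + k + m + 1 + (g + 2 * k - m : ℕ) : ℚ) = 2 * g + 3 * k + 1 by
      linear_combination hn' + hq]
    field_simp
  · rw [oddBase, Nat.descFactorial_of_lt (by omega)]
    simp

theorem evenFunctional_one (g m : ℕ) (hm : m ≤ g) :
    evenFunctional g m 1 = (g + m).factorial / ((2 * m).factorial * (g - m).factorial) := by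
  obtain ⟨h, rfl⟩ := Nat.exists_eq_add_of_le hm
  rw [evenFunctional, LinearMap.comp_apply, LinearMap.mulLeft_apply, mul_one,
    PowerSeries.coeff_one_sub_X_pow_choose, show m + (m + h) = 2 * m + h by ring,
    Nat.cast_add_choose, show m + h + m = 2 * m + h by ring, Nat.add_sub_cancel_left]
  simp

theorem cast_descFactorial_succ (n k : ℕ) :
    (n.descFactorial (k + 1) : ℚ) = (n - k) * n.descFactorial k := by
  rcases le_or_gt k n with h | h
  · rw [Nat.descFactorial_succ, Nat.cast_mul, Nat.cast_sub h]
  · rw [Nat.descFactorial_of_lt h, Nat.descFactorial_of_lt (by omega)]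
    simp

theorem descFactorial_succ_div_factorial (n k : ℕ) :
    (n.descFactorial (k + 1) : ℚ) / n.factorial = (n - k) * (n.descFactorial k / n.factorial) := by
  rw [cast_descFactorial_succ, mul_div_assoc]

theorem inv_factorial_succ (n : ℕ) :
    ((n.factorial : ℚ))⁻¹ = (n + 1) * (((n + 1).factorial : ℚ))⁻¹ := by
  rw [Nat.factorial_succ]
  push_cast
  field_simp

theorem descFactorial_div_factorial_add_two (n k : ℕ) :
    ((n + 2).descFactorial k : ℚ) / (n + 2).factorial * (n + 2 - k) * (n + 1 - k) =
      n.descFactorial k / n.factorial := by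
  have h1 := cast_descFactorial_succ (n + 2) k
  have h2 := cast_descFactorial_succ (n + 2) (k + 1)
  rw [Nat.succ_descFactorial_succ, Nat.succ_descFactorial_succ, h1] at h2
  simp only [Nat.factorial_succ]
  push_cast at h2 ⊢
  field_simp
  linear_combination -h2

/-- Weights of the combination of `evenFunctional`s that kills `antiPoly k` for `k < N`. -/
def evenWt (g N m : ℕ) : ℚ :=
  ∏ i ∈ Finset.range m, (-2 * (2 * i + 1) * (N - i) * (g + 1 + N + i) /
    ((g + 1 + i) * (g + 2 * N + 2 + i) * (g + 2 * N - i)) : ℚ)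

/-- Weights (up to a linear factor) of the combination of `oddFunctional`s that kills
`symPoly k` for `k < N`. -/
def oddWt (g N m : ℕ) : ℚ :=
  ∏ i ∈ Finset.range m, (-2 * (2 * i + 3) * (N - i) * (g + 1 + N + i) /
    ((g + i) * (g + 2 * N + 3 + i) * (g + 2 * N - 1 - i)) : ℚ)

theorem evenWt_succ (g N m : ℕ) (hg : 0 < g) (hm : m ≤ N) :
    evenWt g N (m + 1) * ((g + 1 + m) * (g + 2 * N + 2 + m) * (g + 2 * N - m)) =
      evenWt g N m * (-2 * (2 * m + 1) * (N - m) * (g + 1 + N + m)) := by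
  have hg' : (0 : ℚ) < g := by exact_mod_cast hg
  have hm' : (m : ℚ) ≤ N := by exact_mod_cast hm
  have h1 : (g + 1 + m : ℚ) ≠ 0 := by positivity
  have h2 : (g + 2 * N + 2 + m : ℚ) ≠ 0 := by positivity
  have h3 : (g + 2 * N - m : ℚ) ≠ 0 := by
    have : (0 : ℚ) ≤ N := by positivity
    linarith
  rw [evenWt, Finset.prod_range_succ, ← evenWt]
  field_simp

theorem oddWt_succ (g N m : ℕ) (hg : 1 < g) (hm : m ≤ N) :
    oddWt g N (m + 1) * ((g + m) * (g + 2 * N + 3 + m) * (g + 2 * N - 1 - m)) =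
      oddWt g N m * (-2 * (2 * m + 3) * (N - m) * (g + 1 + N + m)) := by
  have hg' : (1 : ℚ) < g := by exact_mod_cast hg
  have hm' : (m : ℚ) ≤ N := by exact_mod_cast hm
  have h1 : (g + m : ℚ) ≠ 0 := by positivity
  have h2 : (g + 2 * N + 3 + m : ℚ) ≠ 0 := by positivity
  have h3 : (g + 2 * N - 1 - m : ℚ) ≠ 0 := by
    have : (0 : ℚ) ≤ N := by positivity
    linarith
  rw [oddWt, Finset.prod_range_succ, ← oddWt]
  field_simp

theorem evenWt_last (g N : ℕ) : evenWt g N (N + 1) = 0 := by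
  simp [evenWt, Finset.prod_range_succ]

theorem oddWt_last (g N : ℕ) : oddWt g N (N + 1) = 0 := by
  simp [oddWt, Finset.prod_range_succ]

theorem evenWt_ne_zero (g N m : ℕ) (hm : m ≤ N) (hg : 0 < g) : evenWt g N m ≠ 0 := by
  refine Finset.prod_ne_zero_iff.2 fun i hi => ?_
  have hi' : (i + 1 : ℚ) ≤ N := by
    have := Finset.mem_range.1 hi
    exact_mod_cast (by omega : i + 1 ≤ N)
  have hg' : (0 : ℚ) < g := by exact_mod_cast hg
  have h0 : (0 : ℚ) ≤ i := by positivity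
  have h1 : (0 : ℚ) < N - i := by linarith
  have h2 : (0 : ℚ) < g + 2 * N - i := by linarith
  exact div_ne_zero (by simp only [neg_mul]; exact neg_ne_zero.2 (by positivity) )
    (by positivity)

theorem oddWt_ne_zero (g N m : ℕ) (hm : m ≤ N) (hg : 1 < g) : oddWt g N m ≠ 0 := by
  refine Finset.prod_ne_zero_iff.2 fun i hi => ?_
  have hi' : (i + 1 : ℚ) ≤ N := by
    have := Finset.mem_range.1 hi
    exact_mod_cast (by omega : i + 1 ≤ N)
  have hg' : (1 : ℚ) < g := by exact_mod_cast hg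
  have h0 : (0 : ℚ) ≤ i := by positivity
  have h1 : (0 : ℚ) < N - i := by linarith
  have h2 : (0 : ℚ) < g + 2 * N - 1 - i := by linarith
  exact div_ne_zero (by simp only [neg_mul]; exact neg_ne_zero.2 (by positivity))
    (by positivity)

/-- Up to sign, the value at `antiPoly k` of the weighted sum of `evenFunctional`s. -/
def evenSum (g N k : ℕ) : ℚ :=
  ∑ m ∈ Finset.range (N + 1), (3 * m + g + 1) * evenBase g m k * evenWt g N m

/-- Up to a linear factor, the value at `symPoly k` of the weighted sum of `oddFunctional`s. -/
def oddSum (g N k : ℕ) : ℚ :=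
  ∑ m ∈ Finset.range (N + 1), (3 * m + g + 2) * oddBase g m k * oddWt g N m

set_option maxRecDepth 10000 in
theorem evenSum_partial (g N k j : ℕ) (hN : N ≤ g) (hg : 0 < g) (hj : j ≤ N + 1) :
    ∑ m ∈ Finset.range j,
        ((k + 1) * (2 * N - k) * (2 * g + 2 * N + k + 2) *
            ((3 * m + g + 1) * evenBase g m k * evenWt g N m) +
          2 * (2 * g + 2 * k + 3) * (g + N + k + 2) * (N - k - 1) *
            ((3 * m + g + 1) * evenBase g m (k + 1) * evenWt g N m)) =
      -(2 * g + 3 * k + 4) * ((g + k + j).factorial *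
        (((2 * j).descFactorial k : ℚ) / (2 * j).factorial) / (g + 3 + 2 * k - j).factorial *
          evenWt g N j * ((2 * j - k) * (2 * j - k - 1) * (g + j) * (g + 1 + 2 * N + j) *
            (g + 1 + 2 * N - j))) := by
  induction j with
  | zero =>
    rcases k with _ | k <;> simp
  | succ m ih =>
    rw [Finset.sum_range_succ, ih (by omega)]
    have hw := evenWt_succ g N m hg (by omega)
    have hd := descFactorial_div_factorial_add_two (2 * m) k
    have hd1 := descFactorial_succ_div_factorial (2 * m) k
    obtain ⟨e, rfl⟩ : ∃ e, g = m + e := ⟨g - m, by omega⟩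
    have hE1 : m + e + 1 + 2 * k - m = e + 2 * k + 1 := by omega
    have hE2 : m + e + 1 + 2 * (k + 1) - m = e + 2 * k + 1 + 1 + 1 := by omega
    have hE3 : m + e + 3 + 2 * k - m = e + 2 * k + 1 + 1 + 1 := by omega
    have hE4 : m + e + 3 + 2 * k - (m + 1) = e + 2 * k + 1 + 1 := by omega
    have hF1 : m + e + (k + 1) + m = m + e + k + m + 1 := by ring
    have hF2 : m + e + k + (m + 1) = m + e + k + m + 1 := by ring
    simp only [evenBase, hE1, hE2, hE3, hE4, hF1, hF2, hd1, Nat.factorial_succ (m + e + k + m),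
      show 2 * (m + 1) = 2 * m + 2 by ring]
    push_cast at hd hw ⊢
    generalize ((2 * m + 2).descFactorial k : ℚ) / (2 * m + 2).factorial = u' at hd ⊢
    generalize ((2 * m).descFactorial k : ℚ) / (2 * m).factorial = u at hd ⊢
    generalize evenWt (m + e) N (m + 1) = w' at hw ⊢
    generalize evenWt (m + e) N m = w at hw ⊢
    simp only [div_eq_mul_inv]
    rw [inv_factorial_succ (e + 2 * k + 1), inv_factorial_succ (e + 2 * k + 1 + 1)]
    generalize ((e + 2 * k + 1 + 1 + 1).factorial : ℚ)⁻¹ = z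
    generalize ((m + e + k + m).factorial : ℚ) = F
    push_cast at hd hw ⊢
    set c : ℚ := (2 * (m + e) + 3 * k + 4) * F * z * (e + 2 * k + 3) * (m + e + k + m + 1)
    linear_combination c * (w' * (m + e + 1 + m) * (m + e + 2 * N + 2 + m) * (m + e + 2 * N - m)) * hd
      + c * u * hw

set_option maxRecDepth 10000 in
theorem oddSum_partial (g N k j : ℕ) (hN : N ≤ g) (hg : 1 < g) (hj : j ≤ N + 1) :
    ∑ m ∈ Finset.range j,
        ((k + 2) * (2 * N - k + 1) * (2 * g + 2 * N + k + 1) *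
            ((3 * m + g + 2) * oddBase g m k * oddWt g N m) +
          2 * (2 * g + 2 * k + 1) * (g + N + k + 2) * (N - k - 1) *
            ((3 * m + g + 2) * oddBase g m (k + 1) * oddWt g N m)) =
      -(2 * g + 3 * k + 3) * ((g + k + j).factorial *
        (((2 * j + 1).descFactorial k : ℚ) / (2 * j + 1).factorial) / (g + 2 + 2 * k - j).factorial *
          oddWt g N j * ((2 * j + 1 - k) * (2 * j - k) * (g + j - 1) * (g + 2 + 2 * N + j) *
            (g + 2 * N - j))) := by
  induction j with
  | zero =>
    rcases k with _ | _ | k <;> simp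
  | succ m ih =>
    rw [Finset.sum_range_succ, ih (by omega)]
    have hw := oddWt_succ g N m hg (by omega)
    have hd := descFactorial_div_factorial_add_two (2 * m + 1) k
    have hd1 := descFactorial_succ_div_factorial (2 * m + 1) k
    obtain ⟨e, rfl⟩ : ∃ e, g = m + e := ⟨g - m, by omega⟩
    have hE1 : m + e + 2 * k - m = e + 2 * k := by omega
    have hE2 : m + e + 2 * (k + 1) - m = e + 2 * k + 1 + 1 := by omega
    have hE3 : m + e + 2 + 2 * k - m = e + 2 * k + 1 + 1 := by omega
    have hE4 : m + e + 2 + 2 * k - (m + 1) = e + 2 * k + 1 := by omega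
    have hF1 : m + e + (k + 1) + m = m + e + k + m + 1 := by ring
    have hF2 : m + e + k + (m + 1) = m + e + k + m + 1 := by ring
    simp only [oddBase, hE1, hE2, hE3, hE4, hF1, hF2, hd1, Nat.factorial_succ (m + e + k + m),
      show 2 * (m + 1) + 1 = 2 * m + 1 + 2 by ring]
    push_cast at hd hw ⊢
    generalize ((2 * m + 1 + 2).descFactorial k : ℚ) / (2 * m + 1 + 2).factorial = u' at hd ⊢
    generalize ((2 * m + 1).descFactorial k : ℚ) / (2 * m + 1).factorial = u at hd ⊢
    generalize oddWt (m + e) N (m + 1) = w' at hw ⊢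
    generalize oddWt (m + e) N m = w at hw ⊢
    simp only [div_eq_mul_inv]
    rw [inv_factorial_succ (e + 2 * k), inv_factorial_succ (e + 2 * k + 1)]
    generalize ((e + 2 * k + 1 + 1).factorial : ℚ)⁻¹ = z
    generalize ((m + e + k + m).factorial : ℚ) = F
    push_cast at hd hw ⊢
    set c : ℚ := (2 * (m + e) + 3 * k + 3) * F * z * (e + 2 * k + 2) * (m + e + k + m + 1)
    linear_combination c * (w' * (m + e + m) * (m + e + 2 * N + 3 + m) * (m + e + 2 * N - 1 - m)) * hd
      + c * u * hw

theorem evenSum_recurrence (g N k : ℕ) (hN : N < g) :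
    (k + 1) * (2 * N - k) * (2 * g + 2 * N + k + 2) * evenSum g N k =
      2 * (2 * g + 2 * k + 3) * (g + N + k + 2) * (k + 1 - N) * evenSum g N (k + 1) := by
  have h := evenSum_partial g N k (N + 1) hN.le (by omega) le_rfl
  rw [Finset.sum_add_distrib, ← Finset.mul_sum, ← Finset.mul_sum, evenWt_last, ← evenSum,
    ← evenSum] at h
  linear_combination h

theorem oddSum_recurrence (g N k : ℕ) (hN : N + 1 < g) :
    (k + 2) * (2 * N - k + 1) * (2 * g + 2 * N + k + 1) * oddSum g N k =
      2 * (2 * g + 2 * k + 1) * (g + N + k + 2) * (k + 1 - N) * oddSum g N (k + 1) := by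
  have h := oddSum_partial g N k (N + 1) (by omega) (by omega) le_rfl
  rw [Finset.sum_add_distrib, ← Finset.mul_sum, ← Finset.mul_sum, oddWt_last, ← oddSum,
    ← oddSum] at h
  linear_combination h

theorem eq_zero_of_recurrence (S a b : ℕ → ℚ) (N : ℕ) (h : ∀ k < N, a k * S k = b k * S (k + 1))
    (ha : ∀ k < N, a k ≠ 0) (hb : ∀ k, k + 1 = N → b k = 0) (k : ℕ) (hk : k < N) : S k = 0 := by
  obtain ⟨d, hd⟩ : ∃ d, N = k + 1 + d := ⟨N - (k + 1), by omega⟩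
  refine (mul_eq_zero.1 ((h k hk).trans ?_)).resolve_left (ha k hk)
  induction d generalizing k with
  | zero => rw [hb k hd.symm, zero_mul]
  | succ d ih =>
    have h0 := ih (k + 1) (by omega) (by omega)
    rw [(mul_eq_zero.1 ((h (k + 1) (by omega)).trans h0)).resolve_left (ha _ (by omega)), mul_zero]

theorem mul_prod_of_recurrence (S a b : ℕ → ℚ) (N j : ℕ)
    (h : ∀ k, a k * S k = b k * S (k + 1)) :
    S N * ∏ i ∈ Finset.range j, a (N + i) = S (N + j) * ∏ i ∈ Finset.range j, b (N + i) := by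
  induction j with
  | zero => simp
  | succ j ih =>
    rw [Finset.prod_range_succ, Finset.prod_range_succ, ← mul_assoc, ih, ← add_assoc]
    linear_combination (∏ i ∈ Finset.range j, b (N + i)) * h (N + j)

theorem evenSum_eq_zero (g N k : ℕ) (hN : N < g) (hk : k < N) : evenSum g N k = 0 := by
  refine eq_zero_of_recurrence (evenSum g N) _ _ N (fun k _ => evenSum_recurrence g N k hN)
    (fun k hk => ?_) (fun k hk => ?_) k hk
  · have hk' : (k : ℚ) < N := by exact_mod_cast hk
    have h0 : (0 : ℚ) ≤ k := by positivity
    have h1 : (0 : ℚ) < 2 * N - k := by linarith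
    positivity
  · rw [← hk]
    push_cast
    ring

theorem oddSum_eq_zero (g N k : ℕ) (hN : N + 1 < g) (hk : k < N) : oddSum g N k = 0 := by
  refine eq_zero_of_recurrence (oddSum g N) _ _ N (fun k _ => oddSum_recurrence g N k hN)
    (fun k hk => ?_) (fun k hk => ?_) k hk
  · have hk' : (k : ℚ) < N := by exact_mod_cast hk
    have h0 : (0 : ℚ) ≤ k := by positivity
    have h1 : (0 : ℚ) < 2 * N - k + 1 := by linarith
    positivity
  · rw [← hk]
    push_cast
    ring

theorem evenSum_top (g N : ℕ) (hN : N ≤ g) : evenSum g N (2 * N) = evenWt g N N := by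
  rw [evenSum, Finset.sum_range_succ, Finset.sum_eq_zero, zero_add, evenBase,
    Nat.descFactorial_self, show g + 1 + 2 * (2 * N) - N = g + 2 * N + N + 1 by omega,
    Nat.factorial_succ]
  · push_cast
    field_simp
    ring
  · intro m hm
    rw [evenBase, Nat.descFactorial_of_lt (by have := Finset.mem_range.1 hm; omega)]
    simp

theorem oddSum_top (g N : ℕ) (hN : N ≤ g) : oddSum g N (2 * N + 1) = oddWt g N N := by
  rw [oddSum, Finset.sum_range_succ, Finset.sum_eq_zero, zero_add, oddBase,
    Nat.descFactorial_self, show g + 2 * (2 * N + 1) - N = g + (2 * N + 1) + N + 1 by omega,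
    Nat.factorial_succ (g + (2 * N + 1) + N)]
  · push_cast
    field_simp
    ring
  · intro m hm
    rw [oddBase, Nat.descFactorial_of_lt (by have := Finset.mem_range.1 hm; omega)]
    simp

theorem prod_sub_range (n : ℕ) : ∏ i ∈ Finset.range n, ((n : ℚ) - i) = n.factorial := by
  rw [← Finset.prod_range_reflect, ← Finset.prod_range_add_one_eq_factorial]
  push_cast
  refine Finset.prod_congr rfl fun i hi => ?_
  have h : n - 1 - i + (i + 1) = n := by have := Finset.mem_range.1 hi; omega
  have h' : ((n - 1 - i : ℕ) : ℚ) + (i + 1) = n := by exact_mod_cast h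
  linear_combination -h'

theorem rising_two_mul (x : ℚ) (j : ℕ) :
    (∏ i ∈ Finset.range j, 2 * (x + 2 * i)) * rising ((x + 1) / 2) j = rising x (2 * j) := by
  induction j with
  | zero => simp [rising_zero]
  | succ j ih =>
    rw [Finset.prod_range_succ, mul_add_one, rising_succ, rising_succ, rising_succ, ← ih]
    push_cast
    ring

theorem evenSum_diag (g N : ℕ) (hN : N < g) :
    evenSum g N N * (rising (N + 1) N * rising (2 * g + 3 * N + 2) N * rising (g + N + 2) N) =
      evenWt g N N * (rising (2 * g + 2 * N + 3) (2 * N) * rising (g + 2 * N + 2) N) := by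
  have h := mul_prod_of_recurrence (evenSum g N) _ _ N N fun k => evenSum_recurrence g N k hN
  rw [← two_mul, evenSum_top g N hN.le] at h
  have hl : ∏ i ∈ Finset.range N, (((N + i : ℕ) + 1 : ℚ) * (2 * N - (N + i : ℕ)) *
      (2 * g + 2 * N + (N + i : ℕ) + 2)) =
      rising (N + 1) N * N.factorial * rising (2 * g + 3 * N + 2) N := by
    rw [← prod_sub_range, rising, rising, ← Finset.prod_mul_distrib, ← Finset.prod_mul_distrib]
    refine Finset.prod_congr rfl fun i _ => ?_
    push_cast
    ring
  have hr : ∏ i ∈ Finset.range N, (2 * (2 * g + 2 * (N + i : ℕ) + 3 : ℚ) *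
      (g + N + (N + i : ℕ) + 2) * ((N + i : ℕ) + 1 - N)) =
      (∏ i ∈ Finset.range N, 2 * (2 * g + 2 * N + 3 + 2 * i : ℚ)) * rising (g + 2 * N + 2) N *
        N.factorial := by
    rw [← Finset.prod_range_add_one_eq_factorial, rising, Nat.cast_prod,
      ← Finset.prod_mul_distrib, ← Finset.prod_mul_distrib]
    refine Finset.prod_congr rfl fun i _ => ?_
    push_cast
    ring
  rw [hl, hr] at h
  have hf : (N.factorial : ℚ) ≠ 0 := by positivity
  rw [← rising_two_mul, show ((2 * g + 2 * N + 3 + 1) / 2 : ℚ) = g + N + 2 by ring]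
  refine mul_left_cancel₀ hf ?_
  linear_combination rising (g + N + 2) N * h

theorem oddSum_diag (g N : ℕ) (hN : N + 1 < g) :
    oddSum g N N * (rising (N + 2) (N + 1) * rising (2 * g + 3 * N + 1) (N + 1) *
        rising (g + N + 1) (N + 1)) =
      oddWt g N N * (rising (2 * g + 2 * N + 1) (2 * (N + 1)) * rising (g + 2 * N + 2) (N + 1)) := by
  have h := mul_prod_of_recurrence (oddSum g N) _ _ N (N + 1) fun k => oddSum_recurrence g N k hN
  rw [← add_assoc, ← two_mul, oddSum_top g N (by omega)] at h
  have hl : ∏ i ∈ Finset.range (N + 1), (((N + i : ℕ) + 2 : ℚ) * (2 * N - (N + i : ℕ) + 1) *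
      (2 * g + 2 * N + (N + i : ℕ) + 1)) =
      rising (N + 2) (N + 1) * (N + 1).factorial * rising (2 * g + 3 * N + 1) (N + 1) := by
    rw [← prod_sub_range, rising, rising, ← Finset.prod_mul_distrib, ← Finset.prod_mul_distrib]
    refine Finset.prod_congr rfl fun i _ => ?_
    push_cast
    ring
  have hr : ∏ i ∈ Finset.range (N + 1), (2 * (2 * g + 2 * (N + i : ℕ) + 1 : ℚ) *
      (g + N + (N + i : ℕ) + 2) * ((N + i : ℕ) + 1 - N)) =
      (∏ i ∈ Finset.range (N + 1), 2 * (2 * g + 2 * N + 1 + 2 * i : ℚ)) *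
        rising (g + 2 * N + 2) (N + 1) * (N + 1).factorial := by
    rw [← Finset.prod_range_add_one_eq_factorial, rising, Nat.cast_prod,
      ← Finset.prod_mul_distrib, ← Finset.prod_mul_distrib]
    refine Finset.prod_congr rfl fun i _ => ?_
    push_cast
    ring
  rw [hl, hr] at h
  have hf : ((N + 1).factorial : ℚ) ≠ 0 := by positivity
  rw [← rising_two_mul, show ((2 * g + 2 * N + 1 + 1) / 2 : ℚ) = g + N + 1 by ring]
  refine mul_left_cancel₀ hf ?_
  linear_combination rising (g + N + 1) (N + 1) * h

theorem rising_eq_factorial_div (x : ℚ) (a k : ℕ) (h : x = a + 1) :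
    rising x k = ((a + k).factorial : ℚ) / (a.factorial : ℚ) := by
  rw [h, rising_natCast]

theorem rising_pos (x : ℚ) (k : ℕ) (h : 0 < x) : 0 < rising x k :=
  Finset.prod_pos fun i _ => by positivity

theorem saalTerm_succ (a b c : ℚ) (n m : ℕ) (hm : m < n) :
    saalTerm a b c n (m + 1) * ((m + 1) * (c + m) * (c - a - b + n - m - 1)) =
      saalTerm a b c n m * ((n - m) * (a + m) * (b + m)) := by
  obtain ⟨d, rfl⟩ : ∃ d, n = m + 1 + d := ⟨n - (m + 1), by omega⟩
  have e2 : m + 1 + d - (m + 1) = d := by omega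
  have e3 : m + 1 + d - m = d + 1 := by omega
  have hc := Nat.choose_succ_right_eq (m + 1 + d) m
  rw [e3] at hc
  have hc' : ((m + 1 + d).choose (m + 1) : ℚ) * (m + 1) = (m + 1 + d).choose m * (d + 1) := by
    exact_mod_cast hc
  have hl : rising (c + m) (d + 1) = (c + m) * rising (c + (m + 1)) d := by
    rw [rising_succ_left, add_assoc]
  simp only [saalTerm, e2, e3, hl]
  rw [rising_succ, rising_succ, rising_succ]
  push_cast
  linear_combination rising a m * rising b m * (a + m) * (b + m) * rising (c + (m + 1)) d *
    rising (c - a - b) d * (c + m) * (c - a - b + d) * hc'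

theorem evenFunctional_one_succ (g m : ℕ) (hm : m < g) :
    evenFunctional g (m + 1) 1 * ((2 * m + 1) * (2 * m + 2)) =
      evenFunctional g m 1 * ((g + m + 1) * (g - m)) := by
  rw [evenFunctional_one g m hm.le, evenFunctional_one g (m + 1) hm]
  obtain ⟨e, rfl⟩ : ∃ e, g = m + 1 + e := ⟨g - (m + 1), by omega⟩
  rw [Nat.add_sub_cancel_left, show m + 1 + e - m = e + 1 by omega,
    show m + 1 + e + (m + 1) = m + 1 + e + m + 1 by ring, show 2 * (m + 1) = 2 * m + 1 + 1 by ring]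
  simp only [Nat.factorial_succ (m + 1 + e + m), Nat.factorial_succ e,
    Nat.factorial_succ (2 * m + 1), Nat.factorial_succ (2 * m)]
  push_cast
  field_simp
  ring

/-- The value at `1` of the weighted sum of `evenFunctional`s. -/
noncomputable def evenOne (g N : ℕ) : ℚ :=
  ∑ m ∈ Finset.range (N + 1), evenFunctional g m 1 * evenWt g N m

theorem evenFunctional_one_mul_evenWt (g N m : ℕ) (hN : N < g) (hm : m ≤ N) :
    evenFunctional g m 1 * evenWt g N m * saalTerm (g + N + 1) (-g) (g + 2 * N + 2) N 0 =
      saalTerm (g + N + 1) (-g) (g + 2 * N + 2) N m := by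
  induction m with
  | zero =>
    rw [evenFunctional_one g 0 (Nat.zero_le _)]
    simp [evenWt]
    field_simp
  | succ m ih =>
    have hs := saalTerm_succ (g + N + 1) (-g) (g + 2 * N + 2) N m (by omega)
    have hr := evenFunctional_one_succ g m (by omega)
    have hw := evenWt_succ g N m (by omega) (by omega)
    rw [← ih (by omega)] at hs
    generalize saalTerm (g + N + 1) (-g) (g + 2 * N + 2) N 0 = s0 at *
    generalize saalTerm (g + N + 1) (-g) (g + 2 * N + 2) N (m + 1) = s1 at *
    have hm' : (m + 1 : ℚ) ≤ N := by exact_mod_cast hm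
    have hg' : (N : ℚ) < g := by exact_mod_cast hN
    have h0 : (0 : ℚ) ≤ m := by positivity
    have h1 : (0 : ℚ) < g + 2 * N - m := by linarith
    have hne : ((2 * m + 1) * (2 * m + 2) * ((g + 1 + m) * (g + 2 * N + 2 + m) *
      (g + 2 * N - m)) : ℚ) ≠ 0 := by positivity
    refine mul_right_cancel₀ hne ?_
    linear_combination evenWt g N (m + 1) * ((g + 1 + m) * (g + 2 * N + 2 + m) *
      (g + 2 * N - m)) * s0 * hr + evenFunctional g m 1 * (g + m + 1) * (g - m) * s0 * hw -
      2 * (2 * m + 1) * (g + m + 1) * hs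

theorem evenOne_eq (g N : ℕ) (hN : N < g) :
    evenOne g N * (rising (g + 2 * N + 2) N * rising (g + N + 1) N) =
      rising (N + 1) N * rising (2 * g + 2 * N + 2) N := by
  have h := saalschutz (g + N + 1) (-g) (g + 2 * N + 2) N
  rw [← Finset.sum_congr rfl fun m hm => evenFunctional_one_mul_evenWt g N m hN
    (Nat.lt_succ_iff.1 (Finset.mem_range.1 hm)), ← Finset.sum_mul, ← evenOne] at h
  rw [show (N + 1 : ℚ) = g + 2 * N + 2 - (g + N + 1) by ring,
    show (2 * g + 2 * N + 2 : ℚ) = g + 2 * N + 2 - -g by ring, ← h]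
  simp only [saalTerm, Nat.choose_zero_right, rising_zero, Nat.sub_zero, Nat.cast_zero, add_zero,
    Nat.cast_one, one_mul]
  rw [show (g + 2 * N + 2 - (g + N + 1) - -g : ℚ) = g + N + 1 by ring]

theorem evenWt_self (g N : ℕ) (hg : 0 < g) :
    evenWt g N N * (rising (g + 1) N * rising (g + 2 * N + 2) N) =
      (-1) ^ N * (2 * N).factorial := by
  have hg' : (0 : ℚ) < g := by exact_mod_cast hg
  have h1 : ∏ i ∈ Finset.range N, (g + 2 * N - i : ℚ) = rising (g + N + 1) N := by
    rw [rising, ← Finset.prod_range_reflect]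
    refine Finset.prod_congr rfl fun i hi => ?_
    have h : N - 1 - i + (i + 1) = N := by have := Finset.mem_range.1 hi; omega
    have h' : ((N - 1 - i : ℕ) : ℚ) + (i + 1) = N := by exact_mod_cast h
    linear_combination -h'
  have h2 : ∏ i ∈ Finset.range N, (-2 * (2 * i + 1) * (N - i) * (g + 1 + N + i) : ℚ) =
      (-1) ^ N * (2 * N).factorial * rising (g + N + 1) N := by
    have h3 : ((2 * N).factorial : ℚ) = (∏ i ∈ Finset.range N, (2 * (1 + 2 * i) : ℚ)) *
        ∏ i ∈ Finset.range N, ((N : ℚ) - i) := by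
      have h4 := rising_two_mul 1 N
      rw [rising_eq_factorial_div _ 0 _ (by norm_num),
        rising_eq_factorial_div _ 0 _ (by norm_num)] at h4
      rw [prod_sub_range]
      simpa using h4.symm
    rw [h3, rising, ← Finset.prod_mul_distrib, ← Finset.card_range N, ← Finset.prod_const,
      Finset.card_range, ← Finset.prod_mul_distrib, ← Finset.prod_mul_distrib]
    refine Finset.prod_congr rfl fun i _ => ?_
    ring
  have hp := rising_pos (g + N + 1) N (by positivity)
  have hq := rising_pos (g + 1) N (by positivity)
  have hr := rising_pos (g + 2 * N + 2) N (by positivity)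
  rw [evenWt, Finset.prod_div_distrib, h2, Finset.prod_mul_distrib, Finset.prod_mul_distrib, h1,
    ← rising, ← rising]
  generalize rising (g + N + 1 : ℚ) N = a at hp ⊢
  generalize rising (g + 1 : ℚ) N = b at hq ⊢
  generalize rising (g + 2 * N + 2 : ℚ) N = c at hr ⊢
  field_simp

theorem evenOne_ne_zero (g N : ℕ) (hN : N < g) : evenOne g N ≠ 0 := by
  have h1 := rising_pos (N + 1) N (by positivity)
  have h2 := rising_pos (2 * g + 2 * N + 2) N (by positivity)
  intro h
  have := evenOne_eq g N hN
  rw [h, zero_mul] at this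
  exact (mul_pos h1 h2).ne this

theorem oddSum_diag_eq (g N : ℕ) (hN : N + 1 < g) :
    (2 * g + 3 * N + 1) * oddSum g N N / ((3 * N + g + 2) * oddWt g N N) =
      2 * rising (g + 1 + 2 * N) (N + 1) * rising (2 * g + 2 * N + 1) (N + 1) /
        (rising (N + 2) (N + 1) * rising (g + 1 + N) (N + 1)) := by
  have hw := oddWt_ne_zero g N N le_rfl (by omega)
  have h := oddSum_diag g N hN
  rw [rising_eq_factorial_div (N + 2) (N + 1) _ (by push_cast; ring),
    rising_eq_factorial_div (2 * g + 3 * N + 1) (2 * g + 3 * N) _ (by push_cast; ring),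
    rising_eq_factorial_div (g + N + 1) (g + N) _ (by push_cast; ring),
    rising_eq_factorial_div (2 * g + 2 * N + 1) (2 * g + 2 * N) _ (by push_cast; ring),
    rising_eq_factorial_div (g + 2 * N + 2) (g + 2 * N + 1) _ (by push_cast; ring)] at h
  rw [rising_eq_factorial_div (N + 2) (N + 1) _ (by push_cast; ring),
    rising_eq_factorial_div (g + 1 + 2 * N) (g + 2 * N) _ (by push_cast; ring),
    rising_eq_factorial_div (g + 1 + N) (g + N) _ (by push_cast; ring),
    rising_eq_factorial_div (2 * g + 2 * N + 1) (2 * g + 2 * N) _ (by push_cast; ring)]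
  rw [show 2 * g + 3 * N + (N + 1) = 2 * g + 4 * N + 1 by ring,
    show 2 * g + 2 * N + 2 * (N + 1) = 2 * g + 4 * N + 1 + 1 by ring,
    show g + N + (N + 1) = g + 2 * N + 1 by ring,
    show g + 2 * N + 1 + (N + 1) = g + 3 * N + 1 + 1 by ring] at h
  rw [show 2 * g + 2 * N + (N + 1) = 2 * g + 3 * N + 1 by ring,
    show g + N + (N + 1) = g + 2 * N + 1 by ring,
    show g + 2 * N + (N + 1) = g + 3 * N + 1 by ring]
  simp only [Nat.factorial_succ (2 * g + 4 * N + 1), Nat.factorial_succ (2 * g + 3 * N),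
    Nat.factorial_succ (g + 2 * N), Nat.factorial_succ (g + 3 * N + 1)] at h ⊢
  push_cast at h ⊢
  rw [div_eq_div_iff (by positivity) (by positivity)]
  field_simp at h ⊢
  rw [show N + 1 + (N + 1) = N + 1 + N + 1 by ring] at h
  refine mul_left_cancel₀ (show (g + 2 * N + 1 : ℚ) ≠ 0 by positivity) ?_
  linear_combination h

theorem evenSum_diag_eq (g N : ℕ) (hN : N + 1 < g) :
    -(evenSum g N N * evenOne g (N + 1)) / (evenOne g N * evenWt g (N + 1) (N + 1)) =
      (2 * g + 2 * N + 2) * rising (g + 2 * N + 2) N * rising (2 * g + 2 * N + 5) N /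
        ((N + 1) * rising (N + 1) N * rising (g + N + 3) N) := by
  have h1 := evenSum_diag g N (by omega)
  have h2 := evenOne_eq g N (by omega)
  have h3 := evenOne_eq g (N + 1) hN
  have h4 := evenWt_self g N (by omega)
  have h5 := evenWt_self g (N + 1) (by omega)
  have hw := evenWt_ne_zero g (N + 1) (N + 1) le_rfl (by omega)
  have ho := evenOne_ne_zero g N (by omega)
  rw [rising_eq_factorial_div (N + 1) N _ (by ring),
    rising_eq_factorial_div (2 * g + 3 * N + 2) (2 * g + 3 * N + 1) _ (by push_cast; ring),
    rising_eq_factorial_div (g + N + 2) (g + N + 1) _ (by push_cast; ring),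
    rising_eq_factorial_div (2 * g + 2 * N + 3) (2 * g + 2 * N + 1 + 1) _ (by push_cast; ring),
    rising_eq_factorial_div (g + 2 * N + 2) (g + 2 * N + 1) _ (by push_cast; ring)] at h1
  rw [rising_eq_factorial_div (N + 1) N _ (by ring),
    rising_eq_factorial_div (g + 2 * N + 2) (g + 2 * N + 1) _ (by push_cast; ring),
    rising_eq_factorial_div (g + N + 1) (g + N) _ (by push_cast; ring),
    rising_eq_factorial_div (2 * g + 2 * N + 2) (2 * g + 2 * N + 1) _ (by push_cast; ring)] at h2
  rw [rising_eq_factorial_div ((N + 1 : ℕ) + 1) (N + 1) _ (by push_cast; ring),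
    rising_eq_factorial_div (g + 2 * (N + 1 : ℕ) + 2) (g + 2 * N + 1 + 1 + 1) _ (by push_cast; ring),
    rising_eq_factorial_div (g + (N + 1 : ℕ) + 1) (g + N + 1) _ (by push_cast; ring),
    rising_eq_factorial_div (2 * g + 2 * (N + 1 : ℕ) + 2) (2 * g + 2 * N + 1 + 1 + 1) _
      (by push_cast; ring)] at h3
  rw [rising_eq_factorial_div (g + 1) g _ rfl,
    rising_eq_factorial_div (g + 2 * N + 2) (g + 2 * N + 1) _ (by push_cast; ring)] at h4
  rw [rising_eq_factorial_div (g + 1) g _ rfl,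
    rising_eq_factorial_div (g + 2 * (N + 1 : ℕ) + 2) (g + 2 * N + 1 + 1 + 1) _
      (by push_cast; ring)] at h5
  rw [rising_eq_factorial_div (g + 2 * N + 2) (g + 2 * N + 1) _ (by push_cast; ring),
    rising_eq_factorial_div (2 * g + 2 * N + 5) (2 * g + 2 * N + 1 + 1 + 1 + 1) _
      (by push_cast; ring),
    rising_eq_factorial_div (N + 1) N _ (by ring),
    rising_eq_factorial_div (g + N + 3) (g + N + 1 + 1) _ (by push_cast; ring)]
  rw [show N + N = 2 * N by ring, show 2 * g + 3 * N + 1 + N = 2 * g + 4 * N + 1 by ring,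
    show g + N + 1 + N = g + 2 * N + 1 by ring, show g + 2 * N + 1 + N = g + 3 * N + 1 by ring,
    show 2 * g + 2 * N + 1 + 1 + 2 * N = 2 * g + 4 * N + 1 + 1 by ring] at h1
  rw [show N + N = 2 * N by ring, show 2 * g + 2 * N + 1 + N = 2 * g + 3 * N + 1 by ring,
    show g + N + N = g + 2 * N by ring, show g + 2 * N + 1 + N = g + 3 * N + 1 by ring] at h2
  rw [show N + 1 + (N + 1) = 2 * N + 1 + 1 by ring,
    show 2 * g + 2 * N + 1 + 1 + 1 + (N + 1) = 2 * g + 3 * N + 1 + 1 + 1 + 1 by ring,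
    show g + N + 1 + (N + 1) = g + 2 * N + 1 + 1 by ring,
    show g + 2 * N + 1 + 1 + 1 + (N + 1) = g + 3 * N + 1 + 1 + 1 + 1 by ring] at h3
  rw [show g + 2 * N + 1 + N = g + 3 * N + 1 by ring] at h4
  rw [show g + (N + 1) = g + N + 1 by ring,
    show g + 2 * N + 1 + 1 + 1 + (N + 1) = g + 3 * N + 1 + 1 + 1 + 1 by ring,
    show 2 * (N + 1) = 2 * N + 1 + 1 by ring, pow_succ] at h5
  rw [show N + N = 2 * N by ring,
    show 2 * g + 2 * N + 1 + 1 + 1 + 1 + N = 2 * g + 3 * N + 1 + 1 + 1 + 1 by ring,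
    show g + N + 1 + 1 + N = g + 2 * N + 1 + 1 by ring,
    show g + 2 * N + 1 + N = g + 3 * N + 1 by ring]
  simp only [Nat.factorial_succ] at h1 h2 h3 h4 h5 ⊢
  push_cast at h1 h2 h3 h4 h5 ⊢
  have h0 : ((-1 : ℚ)) ^ N ≠ 0 := by simp
  generalize ((-1 : ℚ)) ^ N = s at *
  rw [eq_div_of_mul_eq (by positivity) h4] at h1
  rw [eq_div_of_mul_eq (by positivity) h1, eq_div_of_mul_eq (by positivity) h2,
    eq_div_of_mul_eq (by positivity) h3, eq_div_of_mul_eq (by positivity) h5]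
  clear h1 h2 h3 h4 h5
  field_simp
  ring

open PowerSeries in
theorem PowerSeries.linearMap_eq_sum_of_X_pow_dvd (φ : ℚ⟦X⟧ →ₗ[ℚ] ℚ) (n : ℕ) (h1 : φ 1 = 0)
    (h : ∀ f, X ^ (n + 1) ∣ f → φ f = 0) (f : ℚ⟦X⟧) :
    φ f = ∑ j ∈ Finset.range n, coeff (j + 1) f * φ (X ^ (j + 1)) := by
  have hf : φ (f - (trunc (n + 1) f : Polynomial ℚ)) = 0 := by
    refine h _ (X_pow_dvd_iff.2 fun m hm => ?_)
    rw [map_sub, Polynomial.coeff_coe, coeff_trunc, if_pos hm, sub_self]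
  have ht : ((trunc (n + 1) f : Polynomial ℚ) : ℚ⟦X⟧) =
      ∑ i ∈ Finset.range (n + 1), coeff i f • (X : ℚ⟦X⟧) ^ i := by
    ext m
    rw [Polynomial.coeff_coe, coeff_trunc, map_sum]
    simp [coeff_X_pow]
  rw [map_sub, sub_eq_zero] at hf
  rw [hf, ht, map_sum, Finset.sum_range_succ']
  simp [h1]

open PowerSeries in
/-- A matrix `[x^{j+1}] D(x^i)` has an explicit determinant as soon as it is triangularised by
polynomials `P r` of degree at most `r` and functionals `χ c` on power series that only involve the
coefficients of `x, …, x^{c+1}`. -/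
theorem prod_mul_det_coeff_eq_prod (D : Polynomial ℚ →ₗ[ℚ] ℚ⟦X⟧) (P : ℕ → Polynomial ℚ)
    (χ : ℕ → ℚ⟦X⟧ →ₗ[ℚ] ℚ) (n : ℕ) (hP : ∀ r, (P r).natDegree ≤ r)
    (hχ1 : ∀ c < n, χ c 1 = 0) (hχ : ∀ c < n, ∀ f, X ^ (c + 2) ∣ f → χ c f = 0)
    (h : ∀ c < n, ∀ r < c, χ c (D (P r)) = 0) :
    (∏ r ∈ Finset.range n, (P r).coeff r * χ r (X ^ (r + 1))) *
      (Matrix.of fun i j : Fin n => coeff (j.1 + 1) (D (Polynomial.X ^ i.1))).det =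
      ∏ r ∈ Finset.range n, χ r (D (P r)) := by
  set B := Matrix.of fun i j : Fin n => coeff (j.1 + 1) (D (Polynomial.X ^ i.1)) with hB
  let R := Matrix.of fun r i : Fin n => (P r).coeff i
  let C := Matrix.of fun j c : Fin n => χ c (X ^ (j.1 + 1))
  have hRB (r j : Fin n) : (R * B) r j = coeff (j.1 + 1) (D (P r)) := by
    have hPr : P r = ∑ i ∈ Finset.range n, (P r).coeff i • Polynomial.X ^ i := by
      conv_lhs => rw [(P r).as_sum_range' n ((hP r).trans_lt r.2)]
      simp [Polynomial.smul_X_eq_monomial]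
    conv_rhs => rw [hPr]
    rw [map_sum, map_sum, Finset.sum_range, Matrix.mul_apply]
    simp [R, B]
  have hRBC (r c : Fin n) : (R * B * C) r c = χ c (D (P r)) := by
    rw [Matrix.mul_apply]
    simp only [hRB, C, Matrix.of_apply]
    rw [← Finset.sum_range fun j => coeff (j + 1) (D (P r)) * χ c (X ^ (j + 1)),
      PowerSeries.linearMap_eq_sum_of_X_pow_dvd (χ c) n (hχ1 c c.2) fun f hf =>
        hχ c c.2 f ((pow_dvd_pow _ (by omega)).trans hf)]
  have hR : R.det = ∏ r ∈ Finset.range n, (P r).coeff r := by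
    rw [Matrix.det_of_isLowerTriangular, Finset.prod_range]
    · rfl
    · intro i j hij
      exact Polynomial.coeff_eq_zero_of_natDegree_lt
        ((hP i).trans_lt (Fin.lt_def.1 (OrderDual.toDual_lt_toDual.1 hij)))
  have hC : C.det = ∏ r ∈ Finset.range n, χ r (X ^ (r + 1)) := by
    rw [Matrix.det_of_isUpperTriangular, Finset.prod_range]
    · rfl
    · intro i j hij
      have hij' : j.1 < i.1 := hij
      exact hχ j j.2 _ (pow_dvd_pow _ (by omega))
  have hM : (R * B * C).det = ∏ r ∈ Finset.range n, χ r (D (P r)) := by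
    rw [Matrix.det_of_isLowerTriangular, Finset.prod_range]
    · simp only [hRBC]
    · intro i j hij
      rw [hRBC]
      exact h j j.2 i (Fin.lt_def.1 (OrderDual.toDual_lt_toDual.1 hij))
  rw [← hM, Matrix.det_mul, Matrix.det_mul, hR, hC, Finset.prod_mul_distrib]
  ring

/-- The sequence `A 0, B 0, A 1, B 1, …`. -/
def interleave {α : Type*} (A B : ℕ → α) (r : ℕ) : α :=
  if r % 2 = 0 then A (r / 2) else B (r / 2)

theorem interleave_two_mul {α : Type*} (A B : ℕ → α) (k : ℕ) : interleave A B (2 * k) = A k := by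
  simp [interleave]

theorem interleave_two_mul_add_one {α : Type*} (A B : ℕ → α) (k : ℕ) :
    interleave A B (2 * k + 1) = B k := by
  rw [interleave, if_neg (by omega), show (2 * k + 1) / 2 = k by omega]

theorem prod_range_two_mul (f : ℕ → ℚ) (N : ℕ) :
    ∏ r ∈ Finset.range (2 * N), f r = ∏ k ∈ Finset.range N, (f (2 * k) * f (2 * k + 1)) := by
  induction N with
  | zero => simp
  | succ N ih =>
    rw [show 2 * (N + 1) = 2 * N + 1 + 1 by ring, Finset.prod_range_succ, Finset.prod_range_succ,
      Finset.prod_range_succ, ih, mul_assoc]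

theorem coeff_symPoly (k : ℕ) : (symPoly k).coeff (2 * k) = (-1) ^ k := by
  rw [symPoly, mul_pow, two_mul, Polynomial.coeff_X_pow_mul]
  have h := Polynomial.coeff_pow_of_natDegree_le (p := (1 - Polynomial.X : Polynomial ℚ)) (m := k)
    (n := 1) (by compute_degree)
  simpa [Polynomial.coeff_one] using h

theorem natDegree_symPoly_le (k : ℕ) : (symPoly k).natDegree ≤ 2 * k := by
  rw [mul_comm, symPoly]
  exact Polynomial.natDegree_pow_le_of_le k (by compute_degree)

theorem natDegree_antiPoly_le (k : ℕ) : (antiPoly k).natDegree ≤ 2 * k + 1 := by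
  refine (Polynomial.natDegree_mul_le_of_le (m := 1) (by compute_degree)
    (natDegree_symPoly_le k)).trans (by omega)

theorem coeff_antiPoly (k : ℕ) : (antiPoly k).coeff (2 * k + 1) = -2 * (-1) ^ k := by
  rw [antiPoly, add_comm, Polynomial.coeff_mul_add_eq_of_natDegree_le (by compute_degree)
    (natDegree_symPoly_le k), coeff_symPoly]
  simp [Polynomial.coeff_one]

/-- The weighted sum of `evenFunctional`s that kills `antiPoly k` for `k < N`. -/
noncomputable def evenComb (g N : ℕ) : PowerSeries ℚ →ₗ[ℚ] ℚ :=
  ∑ m ∈ Finset.range (N + 1), evenWt g N m • evenFunctional g m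

/-- The weighted sum of `oddFunctional`s that kills `symPoly k` for `k < N`. -/
noncomputable def oddComb (g N : ℕ) : PowerSeries ℚ →ₗ[ℚ] ℚ :=
  ∑ m ∈ Finset.range (N + 1), ((3 * m + g + 2) * oddWt g N m) • oddFunctional g m

theorem evenComb_apply (g N : ℕ) (f : PowerSeries ℚ) :
    evenComb g N f = ∑ m ∈ Finset.range (N + 1), evenWt g N m * evenFunctional g m f := by
  simp [evenComb]

theorem oddComb_apply (g N : ℕ) (f : PowerSeries ℚ) :
    oddComb g N f =
      ∑ m ∈ Finset.range (N + 1), (3 * m + g + 2) * oddWt g N m * oddFunctional g m f := by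
  simp [oddComb]

theorem evenComb_one (g N : ℕ) : evenComb g N 1 = evenOne g N := by
  simp [evenComb_apply, evenOne, mul_comm]

theorem evenComb_antiPoly (g N k : ℕ) (hN : N ≤ g) :
    evenComb g N (antiPoly k) = (-1) ^ k * evenSum g N k := by
  rw [evenComb_apply, evenSum, Finset.mul_sum]
  refine Finset.sum_congr rfl fun m hm => ?_
  rw [evenFunctional_antiPoly g m k (by have := Finset.mem_range.1 hm; omega)]
  ring

theorem oddComb_symPoly (g N k : ℕ) (hN : N ≤ g) :
    oddComb g N (symPoly k) = (-1) ^ (k + 1) * ((2 * g + 3 * k + 1) * oddSum g N k) := by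
  rw [oddComb_apply, oddSum, Finset.mul_sum, Finset.mul_sum]
  refine Finset.sum_congr rfl fun m hm => ?_
  rw [oddFunctional_symPoly g m k (by have := Finset.mem_range.1 hm; omega)]
  ring

theorem evenComb_substDiff (g N : ℕ) (hN : N ≤ g) (u : Polynomial ℚ) (ε : ℚ)
    (hu : reflOne u = ε • u) : evenComb g N (substDiff g u) = (ε - 1) * evenComb g N u := by
  rw [evenComb_apply, evenComb_apply, Finset.mul_sum]
  refine Finset.sum_congr rfl fun m hm => ?_
  rw [evenFunctional_substDiff g m (by have := Finset.mem_range.1 hm; omega) u ε hu]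
  ring

theorem oddComb_substDiff (g N : ℕ) (hN : N ≤ g) (u : Polynomial ℚ) (ε : ℚ)
    (hu : reflOne u = ε • u) : oddComb g N (substDiff g u) = (-ε - 1) * oddComb g N u := by
  rw [oddComb_apply, oddComb_apply, Finset.mul_sum]
  refine Finset.sum_congr rfl fun m hm => ?_
  rw [oddFunctional_substDiff g m (by have := Finset.mem_range.1 hm; omega) u ε hu]
  ring

theorem evenFunctional_eq_zero (g m : ℕ) (f : PowerSeries ℚ)
    (hf : PowerSeries.X ^ (2 * m + 1) ∣ f) : evenFunctional g m f = 0 :=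
  PowerSeries.X_pow_dvd_iff.1 (hf.mul_left _) _ (by omega)

theorem oddFunctional_eq_zero (g m : ℕ) (f : PowerSeries ℚ)
    (hf : PowerSeries.X ^ (2 * m + 2) ∣ f) : oddFunctional g m f = 0 :=
  PowerSeries.X_pow_dvd_iff.1 (hf.mul_left _) _ (by omega)

theorem evenFunctional_X_pow (g m : ℕ) : evenFunctional g m (PowerSeries.X ^ (2 * m)) = 1 := by
  rw [evenFunctional, LinearMap.comp_apply, LinearMap.mulLeft_apply]
  simp [PowerSeries.coeff_mul_X_pow']

theorem oddFunctional_X_pow (g m : ℕ) :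
    oddFunctional g m (PowerSeries.X ^ (2 * m + 1)) = 2 := by
  rw [oddFunctional, LinearMap.comp_apply, LinearMap.mulLeft_apply]
  simp [PowerSeries.coeff_mul_X_pow', map_ofNat (PowerSeries.constantCoeff (R := ℚ)) 2]

theorem evenComb_eq_zero (g N : ℕ) (f : PowerSeries ℚ)
    (hf : PowerSeries.X ^ (2 * N + 1) ∣ f) : evenComb g N f = 0 := by
  rw [evenComb_apply]
  refine Finset.sum_eq_zero fun m hm => ?_
  rw [evenFunctional_eq_zero g m f ((pow_dvd_pow _ _).trans hf), mul_zero]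
  have := Finset.mem_range.1 hm
  omega

theorem oddComb_eq_zero (g N : ℕ) (f : PowerSeries ℚ)
    (hf : PowerSeries.X ^ (2 * N + 2) ∣ f) : oddComb g N f = 0 := by
  rw [oddComb_apply]
  refine Finset.sum_eq_zero fun m hm => ?_
  rw [oddFunctional_eq_zero g m f ((pow_dvd_pow _ _).trans hf), mul_zero]
  have := Finset.mem_range.1 hm
  omega

theorem evenComb_X_pow (g N : ℕ) : evenComb g N (PowerSeries.X ^ (2 * N)) = evenWt g N N := by
  rw [evenComb_apply, Finset.sum_range_succ, evenFunctional_X_pow, Finset.sum_eq_zero, zero_add,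
    mul_one]
  intro m hm
  rw [evenFunctional_eq_zero g m _ (pow_dvd_pow _ _), mul_zero]
  have := Finset.mem_range.1 hm
  omega

theorem oddComb_X_pow (g N : ℕ) :
    oddComb g N (PowerSeries.X ^ (2 * N + 1)) = (3 * N + g + 2) * oddWt g N N * 2 := by
  rw [oddComb_apply, Finset.sum_range_succ, oddFunctional_X_pow, Finset.sum_eq_zero, zero_add]
  intro m hm
  rw [oddFunctional_eq_zero g m _ (pow_dvd_pow _ _), mul_zero]
  have := Finset.mem_range.1 hm
  omega

/-- The combination of `oddComb g k` and `evenComb g k` that kills `1`. -/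
noncomputable def oddKer (g k : ℕ) : PowerSeries ℚ →ₗ[ℚ] ℚ :=
  oddComb g k - (oddComb g k 1 / evenOne g k) • evenComb g k

/-- The combination of `evenComb g (k + 1)` and `evenComb g k` that kills `1`. -/
noncomputable def evenKer (g k : ℕ) : PowerSeries ℚ →ₗ[ℚ] ℚ :=
  evenComb g (k + 1) - (evenOne g (k + 1) / evenOne g k) • evenComb g k

theorem oddKer_apply (g k : ℕ) (f : PowerSeries ℚ) :
    oddKer g k f = oddComb g k f - oddComb g k 1 / evenOne g k * evenComb g k f := rfl

theorem evenKer_apply (g k : ℕ) (f : PowerSeries ℚ) :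
    evenKer g k f = evenComb g (k + 1) f - evenOne g (k + 1) / evenOne g k * evenComb g k f := rfl

theorem oddKer_substDiff_symPoly (g N k : ℕ) (hN : N < g) :
    oddKer g N (substDiff g (symPoly k)) =
      2 * (-1) ^ k * ((2 * g + 3 * k + 1) * oddSum g N k) := by
  rw [oddKer_apply, oddComb_substDiff g N hN.le _ _ (reflOne_symPoly k),
    evenComb_substDiff g N hN.le _ _ (reflOne_symPoly k), oddComb_symPoly g N k hN.le]
  ring

theorem oddKer_substDiff_antiPoly (g N k : ℕ) (hN : N < g) :
    oddKer g N (substDiff g (antiPoly k)) =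
      2 * (oddComb g N 1 / evenOne g N) * (-1) ^ k * evenSum g N k := by
  rw [oddKer_apply, oddComb_substDiff g N hN.le _ _ (reflOne_antiPoly k),
    evenComb_substDiff g N hN.le _ _ (reflOne_antiPoly k), evenComb_antiPoly g N k hN.le]
  ring

theorem evenKer_substDiff_symPoly (g N k : ℕ) (hN : N < g) :
    evenKer g N (substDiff g (symPoly k)) = 0 := by
  rw [evenKer_apply, evenComb_substDiff g _ hN _ _ (reflOne_symPoly k),
    evenComb_substDiff g N hN.le _ _ (reflOne_symPoly k)]
  ring

theorem evenKer_substDiff_antiPoly (g N k : ℕ) (hN : N < g) :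
    evenKer g N (substDiff g (antiPoly k)) =
      -2 * (-1) ^ k * (evenSum g (N + 1) k - evenOne g (N + 1) / evenOne g N * evenSum g N k) := by
  rw [evenKer_apply, evenComb_substDiff g _ hN _ _ (reflOne_antiPoly k),
    evenComb_substDiff g N hN.le _ _ (reflOne_antiPoly k), evenComb_antiPoly g N k hN.le,
    evenComb_antiPoly g (N + 1) k hN]
  ring

theorem oddKer_X_pow (g N : ℕ) :
    oddKer g N (PowerSeries.X ^ (2 * N + 1)) = (3 * N + g + 2) * oddWt g N N * 2 := by
  rw [oddKer_apply, oddComb_X_pow, evenComb_eq_zero g N _ dvd_rfl]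
  ring

theorem evenKer_X_pow (g N : ℕ) :
    evenKer g N (PowerSeries.X ^ (2 * N + 2)) = evenWt g (N + 1) (N + 1) := by
  rw [evenKer_apply, evenComb_eq_zero g N _ (pow_dvd_pow _ (by omega)),
    show 2 * N + 2 = 2 * (N + 1) by ring, evenComb_X_pow]
  ring

theorem det_coeff_substDiff (g N : ℕ) (hg : N < g) :
    (Matrix.of fun i j : Fin (2 * N) =>
        PowerSeries.coeff (j.1 + 1) (substDiff g (Polynomial.X ^ i.1))).det =
      ∏ k ∈ Finset.range N,
        ((2 * rising (g + 1 + 2 * k) (k + 1) * rising (2 * g + 2 * k + 1) (k + 1) /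
            (rising (k + 2) (k + 1) * rising (g + 1 + k) (k + 1))) *
          ((2 * g + 2 * k + 2) * rising (g + 2 * k + 2) k * rising (2 * g + 2 * k + 5) k /
            ((k + 1) * rising (k + 1) k * rising (g + k + 3) k))) := by
  have h := prod_mul_det_coeff_eq_prod (substDiff g) (interleave symPoly antiPoly)
    (interleave (oddKer g) (evenKer g)) (2 * N) ?_ ?_ ?_ ?_
  · have hne (k : ℕ) (hk : k ∈ Finset.range N) :
        (-1 : ℚ) ^ k * ((3 * k + g + 2) * oddWt g k k * 2) *
          (-2 * (-1) ^ k * evenWt g (k + 1) (k + 1)) ≠ 0 := by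
      have hk' := Finset.mem_range.1 hk
      have h1 := oddWt_ne_zero g k k le_rfl (by omega)
      have h2 := evenWt_ne_zero g (k + 1) (k + 1) le_rfl (by omega)
      have h3 : (3 * k + g + 2 : ℚ) ≠ 0 := by positivity
      simp [h1, h2, h3]
    simp only [prod_range_two_mul, interleave_two_mul, interleave_two_mul_add_one, coeff_symPoly,
      coeff_antiPoly, oddKer_X_pow, add_assoc, one_add_one_eq_two, evenKer_X_pow] at h
    simp only [← add_assoc] at h
    rw [mul_comm] at h
    rw [eq_div_of_mul_eq (Finset.prod_ne_zero_iff.2 hne) h, ← Finset.prod_div_distrib]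
    refine Finset.prod_congr rfl fun k hk => ?_
    have hk' := Finset.mem_range.1 hk
    rw [← oddSum_diag_eq g k (by omega), ← evenSum_diag_eq g k (by omega),
      oddKer_substDiff_symPoly g k k (by omega), evenKer_substDiff_antiPoly g k k (by omega),
      evenSum_eq_zero g (k + 1) k (by omega) (by omega)]
    have h1 := oddWt_ne_zero g k k le_rfl (by omega)
    have h2 := evenWt_ne_zero g (k + 1) (k + 1) le_rfl (by omega)
    have h3 := evenOne_ne_zero g k (by omega)
    field_simp
    ring
  · intro r
    obtain ⟨k, rfl | rfl⟩ := r.even_or_odd'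
    · rw [interleave_two_mul]; exact natDegree_symPoly_le k
    · rw [interleave_two_mul_add_one]; exact natDegree_antiPoly_le k
  · intro c hc
    obtain ⟨k, rfl | rfl⟩ := c.even_or_odd'
    · rw [interleave_two_mul, oddKer_apply, evenComb_one,
        div_mul_cancel₀ _ (evenOne_ne_zero g k (by omega)), sub_self]
    · rw [interleave_two_mul_add_one, evenKer_apply, evenComb_one, evenComb_one,
        div_mul_cancel₀ _ (evenOne_ne_zero g k (by omega)), sub_self]
  · intro c hc f hf
    obtain ⟨k, rfl | rfl⟩ := c.even_or_odd'
    · rw [interleave_two_mul, oddKer_apply, oddComb_eq_zero g k f hf,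
        evenComb_eq_zero g k f ((pow_dvd_pow _ (by omega)).trans hf)]
      ring
    · rw [interleave_two_mul_add_one, evenKer_apply,
        evenComb_eq_zero g (k + 1) f ((pow_dvd_pow _ (by omega)).trans hf),
        evenComb_eq_zero g k f ((pow_dvd_pow _ (by omega)).trans hf)]
      ring
  · intro c hc r hr
    obtain ⟨k, rfl | rfl⟩ := c.even_or_odd' <;> obtain ⟨l, rfl | rfl⟩ := r.even_or_odd'
    · rw [interleave_two_mul, interleave_two_mul, oddKer_substDiff_symPoly g k l (by omega),
        oddSum_eq_zero g k l (by omega) (by omega)]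
      ring
    · rw [interleave_two_mul, interleave_two_mul_add_one,
        oddKer_substDiff_antiPoly g k l (by omega), evenSum_eq_zero g k l (by omega) (by omega)]
      ring
    · rw [interleave_two_mul, interleave_two_mul_add_one,
        evenKer_substDiff_symPoly g k l (by omega)]
    · rw [interleave_two_mul_add_one, interleave_two_mul_add_one,
        evenKer_substDiff_antiPoly g k l (by omega),
        evenSum_eq_zero g k l (by omega) (by omega),
        evenSum_eq_zero g (k + 1) l (by omega) (by omega)]
      ring

theorem poch_ratCast (x : ℚ) (k : ℕ) : poch (x : ℂ) k = (rising x k : ℚ) := by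
  simp [poch, rising]

theorem poch_ratCast_ne_zero (x : ℚ) (k : ℕ) (hx : 0 < x) : poch (x : ℂ) k ≠ 0 := by
  rw [poch_ratCast]
  exact_mod_cast (rising_pos x k hx).ne'

theorem gbinom_natCast (n k : ℕ) : gbinom (n : ℂ) k = n.choose k := by
  rw [gbinom, ← descPochhammer_eval_eq_prod_range, descPochhammer_eval_eq_descFactorial,
    Nat.descFactorial_eq_factorial_mul_choose, Nat.cast_mul,
    mul_div_cancel_left₀ _ (by exact_mod_cast k.factorial_ne_zero)]

theorem coeff_substDiff_X_pow (g i j : ℕ) :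
    PowerSeries.coeff (j + 1) (substDiff g (Polynomial.X ^ i)) =
      (2 * g + 1 + i + j).choose (j + 1) - if i = j + 1 then 1 else 0 := by
  rw [substDiff, LinearMap.sub_apply, map_sub, geomSubst_X_pow, polyIncl_apply,
    show 2 * g + 1 + i = 2 * g + i + 1 by ring,
    PowerSeries.invOneSubPow_val_succ_eq_mk_add_choose, PowerSeries.coeff_mk,
    Polynomial.coeff_coe, Polynomial.coeff_X_pow,
    show 2 * g + i + (j + 1) = 2 * g + i + 1 + j by ring,
    ← Nat.choose_symm_of_eq_add (show 2 * g + i + 1 + j = (2 * g + i) + (j + 1) by ring)]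
  simp only [eq_comm]

theorem Q1_two_mul_add_two (g k : ℕ) :
    Q1 (2 * g + 2) k =
      ((2 * rising (g + 1 + 2 * k) (k + 1) * rising (2 * g + 2 * k + 1) (k + 1) /
        (rising (k + 2) (k + 1) * rising (g + 1 + k) (k + 1)) : ℚ) : ℂ) := by
  rw [Q1]
  push_cast
  simp only [← poch_ratCast]
  push_cast
  congr! 3 <;> ring_nf

theorem Q2_two_mul_add_two (g k : ℕ) :
    Q2 (2 * g + 2) (k + 1) =
      (((2 * g + 2 * k + 2) * rising (g + 2 * k + 2) k * rising (2 * g + 2 * k + 5) k /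
        ((k + 1) * rising (k + 1) k * rising (g + k + 3) k) : ℚ) : ℂ) := by
  rw [Q2]
  push_cast
  simp only [← poch_ratCast]
  push_cast
  congr! 3 <;> ring_nf

theorem bdet_two_mul_add_two (g N : ℕ) (hg : N < g) :
    bdet (2 * g + 2) (2 * N) 0 1 =
      ∏ k ∈ Finset.range N, Q1 (2 * g + 2) k * Q2 (2 * g + 2) (k + 1) := by
  have h := congrArg (algebraMap ℚ ℂ) (det_coeff_substDiff g N hg)
  rw [RingHom.map_det, map_prod] at h
  simp only [map_mul (algebraMap ℚ ℂ), eq_ratCast] at h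
  simp only [Q1_two_mul_add_two, Q2_two_mul_add_two]
  rw [← h, bdet]
  congr 1
  ext i j
  simp only [Matrix.of_apply, RingHom.mapMatrix_apply, Matrix.map_apply, coeff_substDiff_X_pow]
  rw [show (2 * g + 2 + ((0 + i.1 : ℕ) : ℂ) + ((1 + j.1 : ℕ) : ℂ) - 2) =
    ((2 * g + 1 + i + j : ℕ) : ℂ) by push_cast; ring, gbinom_natCast, zero_add, add_comm 1 j.1]
  split_ifs <;> simp
  ring

/-- A function `ℂ → ℂ` given by evaluation of a polynomial. -/
def IsPolyFun (f : ℂ → ℂ) : Prop := ∃ p : Polynomial ℂ, ∀ x, f x = p.eval x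

namespace IsPolyFun

variable {f h : ℂ → ℂ}

theorem const (c : ℂ) : IsPolyFun fun _ => c := ⟨Polynomial.C c, by simp⟩

theorem id : IsPolyFun fun x => x := ⟨Polynomial.X, by simp⟩

theorem add (hf : IsPolyFun f) (hh : IsPolyFun h) : IsPolyFun fun x => f x + h x := by
  obtain ⟨⟨p, hp⟩, q, hq⟩ := And.intro hf hh
  exact ⟨p + q, by simp [hp, hq]⟩

theorem mul (hf : IsPolyFun f) (hh : IsPolyFun h) : IsPolyFun fun x => f x * h x := by
  obtain ⟨⟨p, hp⟩, q, hq⟩ := And.intro hf hh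
  exact ⟨p * q, by simp [hp, hq]⟩

theorem sum {ι : Type*} (s : Finset ι) {F : ι → ℂ → ℂ} (hF : ∀ i, IsPolyFun (F i)) :
    IsPolyFun fun x => ∑ i ∈ s, F i x := by
  choose p hp using hF
  exact ⟨∑ i ∈ s, p i, by simp [hp, Polynomial.eval_finsetSum]⟩

theorem prod {ι : Type*} (s : Finset ι) {F : ι → ℂ → ℂ} (hF : ∀ i, IsPolyFun (F i)) :
    IsPolyFun fun x => ∏ i ∈ s, F i x := by
  choose p hp using hF
  exact ⟨∏ i ∈ s, p i, by simp [hp, Polynomial.eval_prod]⟩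

theorem det {n : ℕ} {F : Fin n → Fin n → ℂ → ℂ} (hF : ∀ i j, IsPolyFun (F i j)) :
    IsPolyFun fun x => (Matrix.of fun i j => F i j x).det := by
  simp only [Matrix.det_apply', Matrix.of_apply]
  exact sum _ fun σ => (const _).mul (prod _ fun i => hF _ _)

theorem poch_comp (hf : IsPolyFun f) (k : ℕ) : IsPolyFun fun x => poch (f x) k :=
  prod _ fun _ => hf.add (const _)

theorem gbinom_comp (hf : IsPolyFun f) (k : ℕ) : IsPolyFun fun x => gbinom (f x) k := by
  simp only [gbinom, div_eq_mul_inv, sub_eq_add_neg]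
  exact (prod _ fun _ => hf.add (const _)).mul (const _)

theorem bdet (n I J : ℕ) : IsPolyFun fun x => bdet x n I J := by
  refine det fun i j => (const _).add (gbinom_comp ?_ _)
  simp only [sub_eq_add_neg]
  exact ((id.add (const _)).add (const _)).add (const _)

theorem eq_of_forall_nat (hf : IsPolyFun f) (hh : IsPolyFun h) (N : ℕ)
    (H : ∀ n : ℕ, N < n → f (2 * n + 2) = h (2 * n + 2)) (x : ℂ) : f x = h x := by
  obtain ⟨⟨p, hp⟩, q, hq⟩ := And.intro hf hh
  suffices p = q by rw [hp, hq, this]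
  refine Polynomial.eq_of_infinite_eval_eq p q (Set.infinite_of_injective_forall_mem
    (f := fun n : ℕ => (2 * (n + N + 1 : ℕ) + 2 : ℂ)) (fun a b hab => ?_) fun n => ?_)
  · simpa using hab
  · rw [Set.mem_ofPred_eq, ← hp, ← hq]
    exact H _ (by omega)

end IsPolyFun

theorem bdet_mul_eq (μ : ℂ) (N : ℕ) :
    bdet μ (2 * N) 0 1 * ∏ k ∈ Finset.range N,
        (poch ((k : ℂ) + 2) (k + 1) * poch (μ / 2 + k) (k + 1)) *
          (((k + 1 : ℕ) : ℂ) * poch ((k + 1 : ℕ) : ℂ) k * poch (μ / 2 + (k + 1 : ℕ) + 1) k) =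
      ∏ k ∈ Finset.range N,
        (2 * poch (μ / 2 + 2 * k) (k + 1) * poch (μ + 2 * k - 1) (k + 1)) *
          ((μ + 2 * (k + 1 : ℕ) - 2) * poch (μ / 2 + 2 * (k + 1 : ℕ) - 1) k *
            poch (μ + 2 * (k + 1 : ℕ) + 1) k) := by
  have half (c : ℂ) : IsPolyFun fun x => x / 2 + c := by
    simp only [div_eq_mul_inv]
    exact (IsPolyFun.id.mul (.const _)).add (.const _)
  refine IsPolyFun.eq_of_forall_nat
    (f := fun μ => bdet μ (2 * N) 0 1 * ∏ k ∈ Finset.range N,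
        (poch ((k : ℂ) + 2) (k + 1) * poch (μ / 2 + k) (k + 1)) *
          (((k + 1 : ℕ) : ℂ) * poch ((k + 1 : ℕ) : ℂ) k * poch (μ / 2 + (k + 1 : ℕ) + 1) k))
    (h := fun μ => ∏ k ∈ Finset.range N,
        (2 * poch (μ / 2 + 2 * k) (k + 1) * poch (μ + 2 * k - 1) (k + 1)) *
          ((μ + 2 * (k + 1 : ℕ) - 2) * poch (μ / 2 + 2 * (k + 1 : ℕ) - 1) k *
            poch (μ + 2 * (k + 1 : ℕ) + 1) k)) ?_ ?_ N (fun g hg => ?_) μ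
  · refine (IsPolyFun.bdet _ _ _).mul (.prod _ fun k => ?_)
    exact ((IsPolyFun.const _).mul ((half _).poch_comp _)).mul
      ((IsPolyFun.const _).mul (((half _).add (.const _)).poch_comp _))
  · simp only [sub_eq_add_neg]
    refine .prod _ fun k => ?_
    exact (((IsPolyFun.const _).mul ((half _).poch_comp _)).mul
      (((IsPolyFun.id.add (.const _)).add (.const _)).poch_comp _)).mul
      (((((IsPolyFun.id.add (.const _)).add (.const _))).mul
        (((half _).add (.const _)).poch_comp _)).mul
        (((IsPolyFun.id.add (.const _)).add (.const _)).poch_comp _))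
  · rw [bdet_two_mul_add_two g N hg, ← Finset.prod_mul_distrib]
    refine Finset.prod_congr rfl fun k _ => ?_
    have e1 := poch_ratCast_ne_zero (k + 2) (k + 1) (by positivity)
    have e2 := poch_ratCast_ne_zero ((2 * g + 2) / 2 + k) (k + 1) (by positivity)
    have e3 := poch_ratCast_ne_zero (k + 1 : ℕ) k (by positivity)
    have e4 := poch_ratCast_ne_zero ((2 * g + 2) / 2 + (k + 1 : ℕ) + 1) k (by positivity)
    have e5 : ((k + 1 : ℕ) : ℂ) ≠ 0 := by exact_mod_cast k.succ_ne_zero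
    simp only [Rat.cast_add, Rat.cast_mul, Rat.cast_div, Rat.cast_natCast, Rat.cast_ofNat,
      Rat.cast_one] at e1 e2 e3 e4
    rw [Q1, Q2, Nat.add_sub_cancel, div_mul_div_comm, div_mul_cancel₀]
    exact mul_ne_zero (mul_ne_zero e1 e2) (mul_ne_zero (mul_ne_zero e5 e3) e4)

/-- Theorem (b01), even case: the determinant `b_n(0,1,μ)`, whenever all
denominators occurring in `Q1`, `Q2` are nonzero. -/
theorem b01_even (μ : ℂ) (n : ℕ) (hn : 0 < n) (hne : Even n)
    (h1 : ∀ k ∈ Finset.range (n / 2),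
      poch ((k : ℂ) + 2) (k + 1) * poch (μ / 2 + k) (k + 1) ≠ 0)
    (h2 : ∀ k ∈ Finset.Icc 1 (n / 2),
      (k : ℂ) * poch (k : ℂ) (k - 1) * poch (μ / 2 + k + 1) (k - 1) ≠ 0) :
    bdet μ n 0 1
      = (∏ k ∈ Finset.range (n / 2), Q1 μ k) * ∏ k ∈ Finset.Icc 1 (n / 2), Q2 μ k := by
  obtain ⟨N, rfl⟩ := hne.two_dvd
  rw [Nat.mul_div_cancel_left N two_pos] at *
  have hIcc : ∏ k ∈ Finset.Icc 1 N, Q2 μ k = ∏ k ∈ Finset.range N, Q2 μ (k + 1) := by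
    rw [← Finset.Ico_add_one_right_eq_Icc, Finset.prod_Ico_eq_prod_range]
    simp only [Nat.add_sub_cancel, add_comm 1]
  rw [hIcc, ← Finset.prod_mul_distrib]
  simp only [Q1, Q2, div_mul_div_comm, Nat.add_sub_cancel]
  rw [Finset.prod_div_distrib]
  refine eq_div_of_mul_eq (Finset.prod_ne_zero_iff.2 fun k hk => ?_) (bdet_mul_eq μ N)
  have hk' := Finset.mem_range.1 hk
  exact mul_ne_zero (h1 k hk) (h2 (k + 1) (Finset.mem_Icc.2 ⟨by omega, by omega⟩))
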